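/- As T → ∞, T^{−1} Σ_{t=1}^{T} E[ v_t v_tᵀ ] converges to ∫₀¹ (G₂(r) ⊗ G₁(r)) M (G₂(r) ⊗ G₁(r))ᵀ dr − ∫₀¹ vec(Σ¹²(r)) vec(Σ¹²(r))ᵀ dr. -/

import Mathlib

open MeasureTheory ProbabilityTheory Matrix Filter
open scoped Kronecker NNReal Topology

noncomputable section

/-- A function satisfies a Lipschitz condition piecewise on a finite number of
sub-intervals partitioning `(0,1]`. -/
def PiecewiseLipschitz (f : ℝ → ℝ) : Prop :=
  ∃ (n : ℕ) (a : Fin (n + 1) → ℝ), a 0 = 0 ∧ a (Fin.last n) = 1 ∧ StrictMono a ∧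
    ∀ i : Fin n, ∃ K : ℝ≥0, LipschitzOnWith K f (Set.Ioc (a i.castSucc) (a i.succ))

/-- Euclidean norm of a finitely indexed real vector. -/
def euclNorm {ι : Type*} [Fintype ι] (x : ι → ℝ) : ℝ := Real.sqrt (∑ i, x i ^ 2)

/-- `v_{T,t} = u_{2t} ⊗ u_{1t} − vec(Σ¹²(t/T))`, where `u_{1t} = G₁(t/T) ε_t`,
`u_{2t} = G₂(t/T) ε_t` and `vec` is column vectorization (index `(i,j) ↦ A j i`). -/
def vSeq {d₁ d₂ : ℕ} (G₁ : ℝ → Matrix (Fin d₁) (Fin (d₁ + d₂)) ℝ)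
    (G₂ : ℝ → Matrix (Fin d₂) (Fin (d₁ + d₂)) ℝ) {Ω' : Type*}
    (ε : ℕ → Ω' → Fin (d₁ + d₂) → ℝ) (T t : ℕ) (ω : Ω') : Fin d₂ × Fin d₁ → ℝ :=
  fun p =>
    (G₂ ((t : ℝ) / T)).mulVec (ε t ω) p.1 * (G₁ ((t : ℝ) / T)).mulVec (ε t ω) p.2
      - (G₁ ((t : ℝ) / T) * (G₂ ((t : ℝ) / T))ᵀ) p.2 p.1

theorem tendsto_nat_ceil_aux (r : ℝ) :
    Tendsto (fun T : ℕ => (⌈r * T⌉ : ℝ) / T) atTop (𝓝 r) := by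
  have hu : Tendsto (fun T : ℕ => r + (T : ℝ)⁻¹) atTop (𝓝 r) := by
    simpa using (tendsto_const_nhds (x := r)).add (tendsto_inv_atTop_nhds_zero_nat (𝕜 := ℝ))
  refine tendsto_of_tendsto_of_tendsto_of_le_of_le' tendsto_const_nhds hu ?_ ?_
  all_goals
    filter_upwards [eventually_gt_atTop 0] with T hT
    have hT' : (0 : ℝ) < T := by exact_mod_cast hT
  · rw [le_div_iff₀ hT']
    exact Int.le_ceil _
  · rw [div_le_iff₀ hT', add_mul, inv_mul_cancel₀ hT'.ne']
    exact (Int.ceil_lt_add_one _).le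

def GoodFn (f : ℝ → ℝ) : Prop :=
  (∃ C : ℝ, ∀ r ∈ Set.Ioc (0 : ℝ) 1, |f r| ≤ C) ∧
    ∀ᵐ r ∂(volume.restrict (Set.Ioc (0 : ℝ) 1)), ContinuousAt f r

theorem GoodFn.mul {f g : ℝ → ℝ} (hf : GoodFn f) (hg : GoodFn g) :
    GoodFn (fun r => f r * g r) := by
  obtain ⟨⟨C, hC⟩, hf⟩ := hf
  obtain ⟨⟨D, hD⟩, hg⟩ := hg
  refine ⟨⟨C * D, fun r hr => ?_⟩, ?_⟩
  · rw [abs_mul]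
    exact mul_le_mul (hC r hr) (hD r hr) (abs_nonneg _) ((abs_nonneg _).trans (hC r hr))
  · filter_upwards [hf, hg] with r h1 h2
    exact h1.mul h2

theorem GoodFn.const (c : ℝ) : GoodFn (fun _ => c) :=
  ⟨⟨|c|, fun _ _ => le_rfl⟩, Eventually.of_forall fun _ => continuousAt_const⟩

theorem GoodFn.sum {ι : Type*} (s : Finset ι) {f : ι → ℝ → ℝ} (hf : ∀ i, GoodFn (f i)) :
    GoodFn (fun r => ∑ i ∈ s, f i r) := by
  choose C hC using fun i => (hf i).1
  refine ⟨⟨∑ i ∈ s, C i, fun r hr => ?_⟩, ?_⟩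
  · exact (Finset.abs_sum_le_sum_abs _ _).trans (Finset.sum_le_sum fun i _ => hC i r hr)
  · have h : ∀ᵐ r ∂(volume.restrict (Set.Ioc (0 : ℝ) 1)), ∀ i ∈ s, ContinuousAt (f i) r := by
      rw [Filter.eventually_all_finset]
      exact fun i _ => (hf i).2
    filter_upwards [h] with r h
    exact tendsto_finsetSum _ h

theorem exists_piece (n : ℕ) (a : Fin (n + 1) → ℝ) (r : ℝ) (h0 : a 0 < r)
    (h1 : r ≤ a (Fin.last n)) : ∃ i : Fin n, r ∈ Set.Ioc (a i.castSucc) (a i.succ) := by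
  by_contra! hcon
  have : ∀ j : Fin (n + 1), a j < r := by
    intro j
    induction j using Fin.induction with
    | zero => exact h0
    | succ i ih =>
      by_contra! hh
      exact hcon i ⟨ih, hh⟩
  exact absurd (this (Fin.last n)) (not_lt.2 h1)

theorem PiecewiseLipschitz.good {f : ℝ → ℝ} (hf : PiecewiseLipschitz f)
    (hb : ∃ C : ℝ, ∀ r ∈ Set.Ioc (0 : ℝ) 1, |f r| ≤ C) : GoodFn f := by
  refine ⟨hb, ?_⟩
  obtain ⟨n, a, h0, h1, -, hL⟩ := hf
  rw [ae_restrict_iff' measurableSet_Ioc]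
  have hne : ∀ᵐ r : ℝ, r ∉ Set.range a :=
    measure_eq_zero_iff_ae_notMem.1 ((Set.finite_range a).measure_zero _)
  filter_upwards [hne] with r hr hr01
  obtain ⟨i, hi⟩ := exists_piece n a r (h0 ▸ hr01.1) (h1 ▸ hr01.2)
  obtain ⟨K, hK⟩ := hL i
  refine (hK.continuousOn).continuousAt (Ioc_mem_nhds hi.1 (lt_of_le_of_ne hi.2 ?_))
  rintro h
  exact hr ⟨_, h.symm⟩

theorem riemann_step (f : ℝ → ℝ) (T : ℕ) (hT : 0 < T) :
    ∫ r in Set.Ioc (0 : ℝ) 1, f ((⌈r * T⌉ : ℝ) / T)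
      = (T : ℝ)⁻¹ * ∑ t ∈ Finset.Icc 1 T, f ((t : ℝ) / T) := by
  have hT' : (0 : ℝ) < T := by exact_mod_cast hT
  have key : ∀ k : ℕ, Set.EqOn (fun r : ℝ => f ((⌈r * T⌉ : ℝ) / T))
      (fun _ => f (((k + 1 : ℕ) : ℝ) / T)) (Set.Ioc ((k : ℝ) / T) (((k + 1 : ℕ) : ℝ) / T)) := by
    intro k r hr
    have h1 := (div_lt_iff₀ hT').1 hr.1
    have h2 := (le_div_iff₀ hT').1 hr.2
    have : ⌈r * T⌉ = ((k + 1 : ℕ) : ℤ) := by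
      rw [Int.ceil_eq_iff]
      push_cast at h2 ⊢
      constructor <;> linarith
    simp only [this, Int.cast_natCast]
  have hle : ∀ k : ℕ, (k : ℝ) / T ≤ ((k + 1 : ℕ) : ℝ) / T := fun k => by
    gcongr; simp
  have hint : ∀ k < T, IntervalIntegrable (fun r : ℝ => f ((⌈r * T⌉ : ℝ) / T)) volume
      ((k : ℝ) / T) (((k + 1 : ℕ) : ℝ) / T) := by
    intro k _
    rw [intervalIntegrable_iff_integrableOn_Ioc_of_le (hle k)]
    exact (integrableOn_congr_fun (key k) measurableSet_Ioc).2 (by simp)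
  have hs := intervalIntegral.sum_integral_adjacent_intervals
    (a := fun k : ℕ => (k : ℝ) / T) hint
  simp only [Nat.cast_zero, zero_div, div_self hT'.ne'] at hs
  rw [← intervalIntegral.integral_of_le zero_le_one, ← hs, Finset.mul_sum,
    Finset.range_eq_Ico, ← Finset.sum_Ico_add' (fun t : ℕ => (T : ℝ)⁻¹ * f ((t : ℝ) / T)) 0 T 1 |>.trans (by rfl : _ = ∑ t ∈ Finset.Icc 1 T, (T : ℝ)⁻¹ * f ((t : ℝ) / T))]
  refine Finset.sum_congr rfl fun k _ => ?_
  rw [intervalIntegral.integral_of_le (hle k), setIntegral_congr_fun measurableSet_Ioc (key k)]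
  have : ((k : ℝ) + 1) / T - k / T = (T : ℝ)⁻¹ := by field_simp; ring
  simp [Real.volume_real_Ioc, this]

theorem GoodFn.riemann {f : ℝ → ℝ} (hf : GoodFn f) :
    Tendsto (fun T : ℕ => (T : ℝ)⁻¹ * ∑ t ∈ Finset.Icc 1 T, f ((t : ℝ) / T)) atTop
      (𝓝 (∫ r in Set.Ioc (0 : ℝ) 1, f r)) := by
  obtain ⟨⟨C, hC⟩, hc⟩ := hf
  have h : Tendsto (fun T : ℕ => ∫ r in Set.Ioc (0 : ℝ) 1, f ((⌈r * T⌉ : ℝ) / T)) atTop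
      (𝓝 (∫ r in Set.Ioc (0 : ℝ) 1, f r)) := by
    refine tendsto_integral_filter_of_dominated_convergence (fun _ => C) ?_ ?_ ?_ ?_
    · refine Eventually.of_forall fun T => ?_
      have h1 : Measurable (fun r : ℝ => ⌈r * T⌉) := Int.measurable_ceil.comp (measurable_id.mul_const _)
      have h2 : Measurable (fun k : ℤ => f ((k : ℝ) / T)) := measurable_from_top
      exact (h2.comp h1).aestronglyMeasurable
    · filter_upwards [eventually_gt_atTop 0] with T hT
      have hT' : (0 : ℝ) < T := by exact_mod_cast hT
      filter_upwards [ae_restrict_mem measurableSet_Ioc] with r hr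
      apply hC
      have h1 : (0 : ℤ) < ⌈r * T⌉ := Int.ceil_pos.2 (mul_pos hr.1 hT')
      have h2 : ⌈r * T⌉ ≤ (T : ℤ) := Int.ceil_le.2 (by
        push_cast
        nlinarith [hr.2])
      constructor
      · exact div_pos (by exact_mod_cast h1) hT'
      · rw [div_le_one hT']
        exact_mod_cast h2
    · simp
    · filter_upwards [hc, ae_restrict_mem measurableSet_Ioc] with r hr hr0
      exact hr.tendsto.comp ((tendsto_nat_ceil_aux r))
  refine h.congr' ?_
  filter_upwards [eventually_gt_atTop 0] with T hT
  exact riemann_step f T hT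

theorem euclNorm_nonneg' {ι : Type*} [Fintype ι] (x : ι → ℝ) : 0 ≤ euclNorm x :=
  Real.sqrt_nonneg _

theorem abs_le_euclNorm {ι : Type*} [Fintype ι] (x : ι → ℝ) (i : ι) : |x i| ≤ euclNorm x := by
  rw [euclNorm, ← Real.sqrt_sq_eq_abs]
  exact Real.sqrt_le_sqrt (Finset.single_le_sum (f := fun i => x i ^ 2)
    (fun i _ => sq_nonneg _) (Finset.mem_univ i))

theorem integrable_four {ι : Type*} [Fintype ι] {Ω : Type*} [MeasurableSpace Ω] (P : Measure Ω)
    (e : Ω → ι → ℝ) (hm : Measurable e) (h4 : Integrable (fun ω => euclNorm (e ω) ^ 4) P)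
    (a b c k : ι) : Integrable (fun ω => e ω a * e ω b * (e ω c * e ω k)) P := by
  have hmi : ∀ i, Measurable fun ω => e ω i := fun i => (measurable_pi_apply i).comp hm
  refine h4.mono' (((hmi a).mul (hmi b)).mul ((hmi c).mul (hmi k))).aestronglyMeasurable ?_
  refine Eventually.of_forall fun ω => ?_
  have h := euclNorm_nonneg' (e ω)
  rw [Real.norm_eq_abs, abs_mul, abs_mul, abs_mul]
  calc _ ≤ (euclNorm (e ω) * euclNorm (e ω)) * (euclNorm (e ω) * euclNorm (e ω)) := by
        gcongr <;> exact abs_le_euclNorm _ _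
    _ = _ := by ring

theorem integrable_two {ι : Type*} [Fintype ι] {Ω : Type*} [MeasurableSpace Ω] (P : Measure Ω)
    [IsProbabilityMeasure P]
    (e : Ω → ι → ℝ) (hm : Measurable e) (h4 : Integrable (fun ω => euclNorm (e ω) ^ 4) P)
    (a b : ι) : Integrable (fun ω => e ω a * e ω b) P := by
  have hmi : ∀ i, Measurable fun ω => e ω i := fun i => (measurable_pi_apply i).comp hm
  refine (h4.add (integrable_const (1 : ℝ))).mono' ((hmi a).mul (hmi b)).aestronglyMeasurable ?_
  refine Eventually.of_forall fun ω => ?_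
  have h := euclNorm_nonneg' (e ω)
  rw [Real.norm_eq_abs, abs_mul]
  calc _ ≤ (euclNorm (e ω) * euclNorm (e ω)) := by
        gcongr <;> exact abs_le_euclNorm _ _
    _ ≤ euclNorm (e ω) ^ 4 + 1 := by nlinarith [sq_nonneg (euclNorm (e ω) ^ 2 - 1), sq_nonneg (euclNorm (e ω) ^ 2)]

theorem moment_calc {d₁ d₂ d : ℕ} (A : Matrix (Fin d₁) (Fin d) ℝ) (B : Matrix (Fin d₂) (Fin d) ℝ)
    {Ω : Type*} [MeasurableSpace Ω] (P : Measure Ω) [IsProbabilityMeasure P]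
    (e : Ω → Fin d → ℝ) (hm : Measurable e)
    (h4 : Integrable (fun ω => euclNorm (e ω) ^ 4) P)
    (hcov : ∀ i j, ∫ ω, e ω i * e ω j ∂P = if i = j then 1 else 0)
    (M : Matrix (Fin d × Fin d) (Fin d × Fin d) ℝ)
    (hM : ∀ p q : Fin d × Fin d, ∫ ω, e ω p.1 * e ω q.1 * (e ω p.2 * e ω q.2) ∂P = M p q)
    (p q : Fin d₂ × Fin d₁) :
    ∫ ω, (B.mulVec (e ω) p.1 * A.mulVec (e ω) p.2 - (A * Bᵀ) p.2 p.1) *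
      (B.mulVec (e ω) q.1 * A.mulVec (e ω) q.2 - (A * Bᵀ) q.2 q.1) ∂P
    = ((B ⊗ₖ A) * M * (B ⊗ₖ A)ᵀ) p q - (A * Bᵀ) p.2 p.1 * (A * Bᵀ) q.2 q.1 := by
  set K := B ⊗ₖ A with hK
  have hA : ∀ (p : Fin d₂ × Fin d₁) ω, B.mulVec (e ω) p.1 * A.mulVec (e ω) p.2
      = ∑ a : Fin d × Fin d, K p a * (e ω a.1 * e ω a.2) := by
    intro p ω
    simp only [Matrix.mulVec, dotProduct, Finset.sum_mul_sum, Fintype.sum_prod_type, hK,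
      Matrix.kroneckerMap_apply]
    refine Finset.sum_congr rfl fun i _ => Finset.sum_congr rfl fun j _ => by ring
  have hI1 : ∀ p : Fin d₂ × Fin d₁,
      Integrable (fun ω => ∑ a : Fin d × Fin d, K p a * (e ω a.1 * e ω a.2)) P := fun p =>
    integrable_finsetSum _ fun a _ => (integrable_two P e hm h4 _ _).const_mul _
  have hE1 : ∀ p : Fin d₂ × Fin d₁,
      ∫ ω, ∑ a : Fin d × Fin d, K p a * (e ω a.1 * e ω a.2) ∂P = (A * Bᵀ) p.2 p.1 := by
    intro p
    rw [integral_finsetSum _ fun a _ => (integrable_two P e hm h4 _ _).const_mul _]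
    simp only [integral_const_mul, hcov, Fintype.sum_prod_type, hK, Matrix.kroneckerMap_apply,
      Matrix.mul_apply, Matrix.transpose_apply, mul_ite, mul_one, mul_zero, Finset.sum_ite_eq,
      Finset.mem_univ, if_true]
    exact Finset.sum_congr rfl fun i _ => mul_comm _ _
  have hprod : ∀ ω, (∑ a : Fin d × Fin d, K p a * (e ω a.1 * e ω a.2)) *
      (∑ a : Fin d × Fin d, K q a * (e ω a.1 * e ω a.2))
      = ∑ b : Fin d × Fin d, ∑ a : Fin d × Fin d,
        (K p a * K q b) * (e ω a.1 * e ω b.1 * (e ω a.2 * e ω b.2)) := by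
    intro ω
    rw [Finset.sum_mul_sum, Finset.sum_comm]
    refine Finset.sum_congr rfl fun i _ => Finset.sum_congr rfl fun j _ => by ring
  have hi4 : ∀ a b : Fin d × Fin d, Integrable (fun ω =>
      (K p a * K q b) * (e ω a.1 * e ω b.1 * (e ω a.2 * e ω b.2))) P := fun a b =>
    (integrable_four P e hm h4 _ _ _ _).const_mul _
  have hI2 : Integrable (fun ω => (∑ a : Fin d × Fin d, K p a * (e ω a.1 * e ω a.2)) *
      (∑ a : Fin d × Fin d, K q a * (e ω a.1 * e ω a.2))) P := by
    simp only [hprod]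
    exact integrable_finsetSum _ fun b _ => integrable_finsetSum _ fun a _ => hi4 a b
  have hE2 : ∫ ω, (∑ a : Fin d × Fin d, K p a * (e ω a.1 * e ω a.2)) *
      (∑ a : Fin d × Fin d, K q a * (e ω a.1 * e ω a.2)) ∂P = (K * M * Kᵀ) p q := by
    simp only [hprod]
    rw [integral_finsetSum _ fun b _ => integrable_finsetSum _ fun a _ => hi4 a b,
      Matrix.mul_apply]
    refine Finset.sum_congr rfl fun b _ => ?_
    rw [integral_finsetSum _ fun a _ => hi4 a b, Matrix.mul_apply, Finset.sum_mul]
    refine Finset.sum_congr rfl fun a _ => ?_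
    rw [integral_const_mul, hM, Matrix.transpose_apply]
    ring
  simp only [hA]
  generalize hs : (A * Bᵀ) p.2 p.1 = s at *
  generalize hs' : (A * Bᵀ) q.2 q.1 = s' at *
  have h1 := hI1 p
  have h2 := hI1 q
  have e1 := hE1 p
  have e2 := hE1 q
  rw [hs] at e1
  rw [hs'] at e2
  generalize hX : (fun ω => ∑ a : Fin d × Fin d, K p a * (e ω a.1 * e ω a.2)) = X at *
  generalize hY : (fun ω => ∑ a : Fin d × Fin d, K q a * (e ω a.1 * e ω a.2)) = Y at *
  have hX' := fun ω => congrFun hX ω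
  have hY' := fun ω => congrFun hY ω
  simp only [hX', hY'] at *
  have : ∀ ω, (X ω - s) * (Y ω - s') = X ω * Y ω - s' * X ω - s * Y ω + s * s' := fun ω => by ring
  simp only [this]
  have j1 : Integrable (fun ω => X ω * Y ω - s' * X ω) P := hI2.sub (h1.const_mul _)
  have j2 : Integrable (fun ω => X ω * Y ω - s' * X ω - s * Y ω) P := j1.sub (h2.const_mul _)
  rw [integral_add j2 (integrable_const _), integral_sub j1 (h2.const_mul _),
    integral_sub hI2 (h1.const_mul _), integral_const_mul, integral_const_mul, hE2, e1, e2]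
  simp
  ring

theorem statement2
    (d₁ d₂ : ℕ) (hd₁ : 1 ≤ d₁) (hd₂ : 1 ≤ d₂)
    (G₁ : ℝ → Matrix (Fin d₁) (Fin (d₁ + d₂)) ℝ)
    (G₂ : ℝ → Matrix (Fin d₂) (Fin (d₁ + d₂)) ℝ)
    (hG₁bdd : ∃ C : ℝ, ∀ r ∈ Set.Ioc (0 : ℝ) 1, ∀ i j, |G₁ r i j| ≤ C)
    (hG₂bdd : ∃ C : ℝ, ∀ r ∈ Set.Ioc (0 : ℝ) 1, ∀ i j, |G₂ r i j| ≤ C)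
    (hG₁lip : ∀ i j, PiecewiseLipschitz fun r => G₁ r i j)
    (hG₂lip : ∀ i j, PiecewiseLipschitz fun r => G₂ r i j)
    {Ω' : Type*} [MeasurableSpace Ω'] (P : Measure Ω') [IsProbabilityMeasure P]
    (ε : ℕ → Ω' → Fin (d₁ + d₂) → ℝ)
    (hmeas : ∀ t, Measurable (ε t))
    (hmom : ∀ t, Integrable (fun ω => euclNorm (ε t ω) ^ 4) P)
    (hcov : ∀ t, ∀ i j, ∫ ω, ε t ω i * ε t ω j ∂P = if i = j then 1 else 0)
    (M : Matrix (Fin (d₁ + d₂) × Fin (d₁ + d₂)) (Fin (d₁ + d₂) × Fin (d₁ + d₂)) ℝ)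
    (hM : ∀ t, ∀ p q : Fin (d₁ + d₂) × Fin (d₁ + d₂),
      ∫ ω, ε t ω p.1 * ε t ω q.1 * (ε t ω p.2 * ε t ω q.2) ∂P = M p q) :
    Tendsto
      (fun T : ℕ => fun p q : Fin d₂ × Fin d₁ =>
        (T : ℝ)⁻¹ * ∑ t ∈ Finset.Icc 1 T, ∫ ω, vSeq G₁ G₂ ε T t ω p * vSeq G₁ G₂ ε T t ω q ∂P)
      atTop
      (𝓝 (fun p q : Fin d₂ × Fin d₁ =>
        (∫ r in Set.Ioc (0 : ℝ) 1, ((G₂ r ⊗ₖ G₁ r) * M * (G₂ r ⊗ₖ G₁ r)ᵀ) p q)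
          - ∫ r in Set.Ioc (0 : ℝ) 1,
              (G₁ r * (G₂ r)ᵀ) p.2 p.1 * (G₁ r * (G₂ r)ᵀ) q.2 q.1)) := by
  rw [tendsto_pi_nhds]
  intro p
  rw [tendsto_pi_nhds]
  intro q
  have hg1 : ∀ i j, GoodFn fun r => G₁ r i j := fun i j =>
    (hG₁lip i j).good (hG₁bdd.imp fun C hC r hr => hC r hr i j)
  have hg2 : ∀ i j, GoodFn fun r => G₂ r i j := fun i j =>
    (hG₂lip i j).good (hG₂bdd.imp fun C hC r hr => hC r hr i j)
  have hS : ∀ p : Fin d₂ × Fin d₁, GoodFn fun r => (G₁ r * (G₂ r)ᵀ) p.2 p.1 := by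
    intro p
    simp only [Matrix.mul_apply, Matrix.transpose_apply]
    exact GoodFn.sum _ fun j => (hg1 _ _).mul (hg2 _ _)
  have hK : GoodFn fun r => ((G₂ r ⊗ₖ G₁ r) * M * (G₂ r ⊗ₖ G₁ r)ᵀ) p q := by
    simp only [Matrix.mul_apply, Matrix.transpose_apply, Matrix.kroneckerMap_apply]
    exact GoodFn.sum _ fun b => (GoodFn.sum _ fun a =>
      ((hg2 _ _).mul (hg1 _ _)).mul (GoodFn.const _)).mul ((hg2 _ _).mul (hg1 _ _))
  refine (hK.riemann.sub ((hS p).mul (hS q)).riemann).congr fun T => ?_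
  rw [← mul_sub, ← Finset.sum_sub_distrib]
  congr 1
  refine Finset.sum_congr rfl fun t _ => ?_
  exact (moment_calc (G₁ ((t : ℝ) / T)) (G₂ ((t : ℝ) / T)) P (ε t) (hmeas t) (hmom t) (hcov t) M
    (hM t) p q).symm


end
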